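/- Let Λ be the E7 lattice: ℤ^7 with B(x,y) = −xᵀCy, where C is the Cartan matrix of E7 (Mathlib's CartanMatrix.E₇). Then: (i) the radical R ⊆ Λ/2Λ has exactly 2 elements; (ii) exactly 64 classes in Λ/2Λ satisfy q₀ = 1; (iii) the unique nonzero element ρ of R satisfies q(ρ) = 1, so R₁ = {ρ}; (iv) a class v with q₀(v) = 1 contains a root (an element e with B(e,e) = −2) if and only if v ≠ ρ; in particular exactly 63 classes contain a root. -/

import Mathlib

open Matrix

/-- The bilinear form of the E7 lattice on `ℤ^7`: `B x y = -xᵀ C y` with `C`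
the Cartan matrix of E7. -/
def E7form (x y : Fin 7 → ℤ) : ℤ := -(x ⬝ᵥ (CartanMatrix.E₇ *ᵥ y))

/-- The submodule `2Λ ⊆ Λ`. -/
def twoSub (M : Type*) [AddCommGroup M] [Module ℤ M] : Submodule ℤ M :=
  LinearMap.range ((2 : ℤ) • (LinearMap.id : M →ₗ[ℤ] M))

/-- The quotient `Λ/2Λ` for the E7 lattice. -/
abbrev V7 : Type := (Fin 7 → ℤ) ⧸ twoSub (Fin 7 → ℤ)

/-- `q₀(c) = 1`: the class `c` has a representative `v` with `B v v / 2` odd. -/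
def q0one (c : V7) : Prop :=
  ∃ v : Fin 7 → ℤ, Submodule.Quotient.mk v = c ∧ (E7form v v / 2) % 2 = 1

/-- `c` lies in the radical `R`: it has a representative `v` with `B v w` even
for every `w`. -/
def inRad (c : V7) : Prop :=
  ∃ v : Fin 7 → ℤ, Submodule.Quotient.mk v = c ∧ ∀ w : Fin 7 → ℤ, (2 : ℤ) ∣ E7form v w

/-- `c ∈ R₁`: `c` lies in the radical and `q(c) = 1 ∈ ℤ/4`. -/
def inR1 (c : V7) : Prop :=
  ∃ v : Fin 7 → ℤ, Submodule.Quotient.mk v = c ∧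
    (∀ w : Fin 7 → ℤ, (2 : ℤ) ∣ E7form v w) ∧ (E7form v v / 2) % 4 = 1

/-- `c` contains a root, i.e. a representative `e` with `B e e = -2`. -/
def hasRoot (c : V7) : Prop :=
  ∃ e : Fin 7 → ℤ, Submodule.Quotient.mk e = c ∧ E7form e e = -2

/-- The quadratic form `B x x / 2` of the E7 lattice, with coefficients in any ring. -/
def E7quad {R : Type*} [CommRing R] (x : Fin 7 → R) : R :=
  x 0 * x 2 + x 1 * x 3 + x 2 * x 3 + x 3 * x 4 + x 4 * x 5 + x 5 * x 6
    - (x 0 ^ 2 + x 1 ^ 2 + x 2 ^ 2 + x 3 ^ 2 + x 4 ^ 2 + x 5 ^ 2 + x 6 ^ 2)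

/-- The nonzero vector of the radical of `Λ/2Λ`, in coordinates mod 2. -/
def E7rho : Fin 7 → ZMod 2 := ![0, 1, 0, 0, 1, 0, 1]

theorem E7form_apply (v w : Fin 7 → ℤ) :
    E7form v w =
      (v 2 - 2 * v 0) * w 0 + (v 3 - 2 * v 1) * w 1 + (v 0 + v 3 - 2 * v 2) * w 2
        + (v 1 + v 2 + v 4 - 2 * v 3) * w 3 + (v 3 + v 5 - 2 * v 4) * w 4
        + (v 4 + v 6 - 2 * v 5) * w 5 + (v 5 - 2 * v 6) * w 6 := by
  simp [E7form, CartanMatrix.E₇, Matrix.mulVec, dotProduct, Fin.sum_univ_succ]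
  ring

theorem E7form_self (v : Fin 7 → ℤ) : E7form v v = 2 * E7quad v := by
  rw [E7form_apply, E7quad]
  ring

theorem E7form_self_div_two (v : Fin 7 → ℤ) : E7form v v / 2 = E7quad v := by
  rw [E7form_self, Int.mul_ediv_cancel_left _ two_ne_zero]

/-- Coordinatewise reduction mod 2. -/
def reduceModTwo : (Fin 7 → ℤ) →ₗ[ℤ] (Fin 7 → ZMod 2) :=
  (Int.castAddHom (ZMod 2)).toIntLinearMap.compLeft (Fin 7)

@[simp]
theorem reduceModTwo_apply (v : Fin 7 → ℤ) (i : Fin 7) : reduceModTwo v i = (v i : ZMod 2) := rfl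

theorem reduceModTwo_surjective : Function.Surjective reduceModTwo := fun b =>
  ⟨fun i => (b i).val, by ext i; simp⟩

theorem twoSub_eq_ker : twoSub (Fin 7 → ℤ) = LinearMap.ker reduceModTwo := by
  ext v
  simp only [twoSub, LinearMap.mem_range, LinearMap.mem_ker, funext_iff, reduceModTwo_apply,
    Pi.zero_apply, ZMod.intCast_zmod_eq_zero_iff_dvd]
  constructor
  · rintro ⟨w, hw⟩ i
    exact ⟨w i, by simp [← hw i]⟩
  · intro h
    choose w hw using h
    exact ⟨w, fun i => by simp [hw i]⟩

/-- The identification of `Λ/2Λ` with `𝔽₂⁷`. -/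
noncomputable def V7equiv : V7 ≃ₗ[ℤ] (Fin 7 → ZMod 2) :=
  (Submodule.quotEquivOfEq _ _ twoSub_eq_ker).trans
    (reduceModTwo.quotKerEquivOfSurjective reduceModTwo_surjective)

theorem V7equiv_mk (v : Fin 7 → ℤ) :
    V7equiv (Submodule.Quotient.mk v) = reduceModTwo v := rfl

theorem exists_mk_eq_and_iff (c : V7) (P : (Fin 7 → ℤ) → Prop) :
    (∃ v : Fin 7 → ℤ, Submodule.Quotient.mk v = c ∧ P v) ↔
      ∃ v : Fin 7 → ℤ, reduceModTwo v = V7equiv c ∧ P v := by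
  simp only [← V7equiv_mk, V7equiv.injective.eq_iff]

theorem E7quad_reduceModTwo (v : Fin 7 → ℤ) :
    E7quad (reduceModTwo v) = ((E7quad v : ℤ) : ZMod 2) := by
  simp [E7quad]

theorem E7quad_reduceModTwo_eq_one_iff (v : Fin 7 → ℤ) :
    E7quad (reduceModTwo v) = 1 ↔ E7quad v % 2 = 1 := by
  rw [E7quad_reduceModTwo, ← Int.odd_iff, ZMod.intCast_eq_one_iff_odd]

theorem q0one_iff (c : V7) : q0one c ↔ E7quad (V7equiv c) = 1 := by
  simp only [q0one, exists_mk_eq_and_iff, E7form_self_div_two, ← E7quad_reduceModTwo_eq_one_iff]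
  obtain ⟨v, hv⟩ := reduceModTwo_surjective (V7equiv c)
  exact ⟨fun ⟨_, hw, h⟩ => hw ▸ h, fun h => ⟨v, hv, hv ▸ h⟩⟩

theorem reduceModTwo_eq_zero_iff (v : Fin 7 → ℤ) :
    reduceModTwo v = 0 ↔ ∀ i, v i % 2 = 0 := by
  simp only [funext_iff, reduceModTwo_apply, Pi.zero_apply, ZMod.intCast_zmod_eq_zero_iff_dvd,
    Int.dvd_iff_emod_eq_zero, Nat.cast_ofNat]

theorem reduceModTwo_eq_E7rho_iff (v : Fin 7 → ℤ) :
    reduceModTwo v = E7rho ↔ v 0 % 2 = 0 ∧ v 1 % 2 = 1 ∧ v 2 % 2 = 0 ∧ v 3 % 2 = 0 ∧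
      v 4 % 2 = 1 ∧ v 5 % 2 = 0 ∧ v 6 % 2 = 1 := by
  simp [funext_iff, Fin.forall_fin_succ, E7rho, ZMod.intCast_zmod_eq_zero_iff_dvd,
    ZMod.intCast_eq_one_iff_odd, Int.odd_iff]

theorem two_dvd_E7form_iff (v : Fin 7 → ℤ) :
    (∀ w, (2 : ℤ) ∣ E7form v w) ↔ reduceModTwo v = 0 ∨ reduceModTwo v = E7rho := by
  rw [reduceModTwo_eq_zero_iff, reduceModTwo_eq_E7rho_iff]
  constructor
  · intro h
    have h' := fun j => h (Pi.single j 1)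
    simp [E7form_apply, Fin.forall_fin_succ, Pi.single_apply] at h' ⊢
    omega
  · intro h w
    rw [E7form_apply]
    simp [Fin.forall_fin_succ] at h
    repeat' apply dvd_add
    all_goals exact Dvd.dvd.mul_right (by omega) _

theorem E7quad_emod_four_of_eq_zero {v : Fin 7 → ℤ} (hv : reduceModTwo v = 0) :
    E7quad v % 4 = 0 := by
  rw [reduceModTwo_eq_zero_iff] at hv
  choose w hw using fun i => Int.dvd_of_emod_eq_zero (hv i)
  have : E7quad v = 4 * E7quad w := by
    simp only [E7quad, hw]
    ring
  omega

theorem E7quad_emod_four_of_eq_E7rho {v : Fin 7 → ℤ} (hv : reduceModTwo v = E7rho) :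
    E7quad v % 4 = 1 := by
  rw [reduceModTwo_eq_E7rho_iff] at hv
  obtain ⟨w, h0, h1, h2, h3, h4, h5, h6⟩ : ∃ w : Fin 7 → ℤ, v 0 = 2 * w 0 ∧ v 1 = 2 * w 1 + 1 ∧
      v 2 = 2 * w 2 ∧ v 3 = 2 * w 3 ∧ v 4 = 2 * w 4 + 1 ∧ v 5 = 2 * w 5 ∧ v 6 = 2 * w 6 + 1 := by
    refine ⟨fun i => v i / 2, ?_⟩
    dsimp only
    omega
  have : E7quad v = 4 * (E7quad w + w 3 - w 1 - w 4 + w 5 - w 6 - 1) + 1 := by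
    simp only [E7quad, h0, h1, h2, h3, h4, h5, h6]
    ring
  omega

theorem inRad_iff (c : V7) : inRad c ↔ V7equiv c = 0 ∨ V7equiv c = E7rho := by
  simp only [inRad, exists_mk_eq_and_iff, two_dvd_E7form_iff]
  obtain ⟨v, hv⟩ := reduceModTwo_surjective (V7equiv c)
  exact ⟨fun ⟨_, hw, h⟩ => hw ▸ h, fun h => ⟨v, hv, hv ▸ h⟩⟩

theorem inR1_iff (c : V7) : inR1 c ↔ V7equiv c = E7rho := by
  simp only [inR1, exists_mk_eq_and_iff, two_dvd_E7form_iff, E7form_self_div_two]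
  constructor
  · rintro ⟨v, hv, h | h, hq⟩
    · have := E7quad_emod_four_of_eq_zero h
      omega
    · rw [← hv, h]
  · intro h
    obtain ⟨v, hv⟩ := reduceModTwo_surjective (V7equiv c)
    have hr := hv.trans h
    exact ⟨v, hv, .inr hr, E7quad_emod_four_of_eq_E7rho hr⟩

/-- Every mod 2 vector with `q₀ = 1` other than `E7rho` lifts to a positive root. The coefficients
are bounded by those of the highest root. -/
theorem exists_root_of_E7quad_eq_one : ∀ b0 b1 b2 b3 b4 b5 b6 : ZMod 2,
    E7quad ![b0, b1, b2, b3, b4, b5, b6] = 1 → ![b0, b1, b2, b3, b4, b5, b6] ≠ E7rho →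
    ∃ w3 : Fin 3, ∃ w0 w1 w2 w4 w5 : Fin 2,
      E7quad ![(b0.val + 2 * w0.val : ℤ), b1.val + 2 * w1.val, b2.val + 2 * w2.val,
        b3.val + 2 * w3.val, b4.val + 2 * w4.val, b5.val + 2 * w5.val, b6.val] = -1 := by
  decide +kernel

theorem hasRoot_iff (c : V7) :
    hasRoot c ↔ E7quad (V7equiv c) = 1 ∧ V7equiv c ≠ E7rho := by
  simp only [hasRoot, exists_mk_eq_and_iff, E7form_self]
  constructor
  · rintro ⟨v, hv, hq⟩
    have hq' : E7quad v = -1 := by omega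
    rw [← hv, E7quad_reduceModTwo_eq_one_iff, hq']
    refine ⟨rfl, fun h => ?_⟩
    have := E7quad_emod_four_of_eq_E7rho h
    omega
  · generalize V7equiv c = b
    rintro ⟨hq, hb⟩
    have hbv : b = ![b 0, b 1, b 2, b 3, b 4, b 5, b 6] := by
      ext i; fin_cases i <;> rfl
    rw [hbv] at hq hb
    obtain ⟨w3, w0, w1, w2, w4, w5, h⟩ := exists_root_of_E7quad_eq_one _ _ _ _ _ _ _ hq hb
    refine ⟨_, ?_, by rw [h]; rfl⟩
    have h2 : (2 : ZMod 2) = 0 := rfl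
    ext i
    fin_cases i <;> simp [h2]

theorem natCard_V7_subtype {p : V7 → Prop} (q : (Fin 7 → ZMod 2) → Prop) [DecidablePred q]
    (h : ∀ c, p c ↔ q (V7equiv c)) : Nat.card {c : V7 // p c} = Fintype.card {b // q b} := by
  rw [← Nat.card_eq_fintype_card]
  exact Nat.card_congr (V7equiv.toEquiv.subtypeEquiv h)

/-- For the E7 lattice: (i) the radical of `Λ/2Λ` has exactly 2
elements; (ii) exactly 64 classes satisfy `q₀ = 1`; (iii) `R₁` consists exactly of
the unique nonzero element of the radical; (iv) a class with `q₀ = 1` contains a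
root iff it is not in `R₁`; in particular exactly 63 classes contain a root. -/
theorem stmt_5 :
    Nat.card {c : V7 // inRad c} = 2 ∧
    Nat.card {c : V7 // q0one c} = 64 ∧
    (∀ c : V7, inR1 c ↔ (inRad c ∧ c ≠ 0)) ∧
    (∀ c : V7, q0one c → (hasRoot c ↔ ¬ inR1 c)) ∧
    Nat.card {c : V7 // hasRoot c} = 63 := by
  have hρ0 : E7rho ≠ 0 := by decide
  refine ⟨?_, ?_, fun c => ?_, fun c hc => ?_, ?_⟩
  · rw [natCard_V7_subtype (fun b => b = 0 ∨ b = E7rho) inRad_iff]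
    decide +kernel
  · rw [natCard_V7_subtype (fun b => E7quad b = 1) q0one_iff]
    decide +kernel
  · rw [inR1_iff, inRad_iff, Ne, ← V7equiv.map_eq_zero_iff]
    grind
  · rw [hasRoot_iff, inR1_iff]
    exact and_iff_right ((q0one_iff c).1 hc)
  · rw [natCard_V7_subtype (fun b => E7quad b = 1 ∧ b ≠ E7rho) hasRoot_iff]
    decide +kernel
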